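/- Let σ be an admissible real structure on ℂl(V), with associated Q-orthogonal decomposition V = V₊ ⊕ V₋ where V₊ = V ∩ V_σ and V₋ = V ∩ iV_σ. The following are equivalent: (1) Q is positive definite on V₊ and negative definite on V₋; (2) the quadratic form Q_σ on V is positive definite; (3) the restriction of Q to V_σ is positive definite; (4) the σ-product (·,·)_σ on ℂl(V) is positive definite. (An admissible σ satisfying these conditions is called a Euclidean real structure.) -/

import Mathlib

noncomputable section

open TensorProduct

variable {V : Type*} [AddCommGroup V] [Module ℝ V]

/-- `ℂl(V)`: the complexified Clifford algebra of `(V, Q)` (convention `v² = Q(v)·1`). -/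
abbrev CCl (Q : QuadraticForm ℝ V) := CliffordAlgebra (Q.baseChange ℂ)

/-- The canonical embedding of the real vector space `V` into `ℂl(V)`. -/
def ιr (Q : QuadraticForm ℝ V) (v : V) : CCl Q :=
  CliffordAlgebra.ι (Q.baseChange ℂ) ((1 : ℂ) ⊗ₜ[ℝ] v)

/-- `V^ℂ`: the complexification of `V`, sitting inside `ℂl(V)`. -/
def VC (Q : QuadraticForm ℝ V) : Submodule ℂ (CCl Q) :=
  LinearMap.range (CliffordAlgebra.ι (Q.baseChange ℂ))

/-- A real structure on `ℂl(V)`: an involutive conjugate-linear algebra automorphism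
stabilizing `V^ℂ`. -/
structure RealStructure (Q : QuadraticForm ℝ V) where
  toFun : CCl Q → CCl Q
  map_add' : ∀ x y, toFun (x + y) = toFun x + toFun y
  map_mul' : ∀ x y, toFun (x * y) = toFun x * toFun y
  map_smul' : ∀ (z : ℂ) (x : CCl Q), toFun (z • x) = (starRingEnd ℂ z) • toFun x
  map_one' : toFun 1 = 1
  invol : ∀ x, toFun (toFun x) = x
  stable : ∀ x ∈ VC Q, toFun x ∈ VC Q

namespace RealStructure

theorem map_zero' {Q : QuadraticForm ℝ V} (σ : RealStructure Q) : σ.toFun 0 = 0 := by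
  have h := σ.map_smul' 0 0
  simpa using h

end RealStructure

/-- The fixed points of a real structure, as a real submodule of `ℂl(V)`. -/
def fixedPoints {Q : QuadraticForm ℝ V} (σ : RealStructure Q) : Submodule ℝ (CCl Q) where
  carrier := {x | σ.toFun x = x}
  add_mem' := by
    intro a b ha hb
    simp only [Set.mem_setOf_eq] at *
    rw [σ.map_add', ha, hb]
  zero_mem' := σ.map_zero'
  smul_mem' := by
    intro r x hx
    simp only [Set.mem_setOf_eq] at *
    rw [← Complex.coe_smul, σ.map_smul', hx]
    simp [Complex.conj_ofReal]

/-- `V_σ = {w ∈ V^ℂ : σ(w) = w}`, as a real submodule of `ℂl(V)`. -/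
def VFix {Q : QuadraticForm ℝ V} (σ : RealStructure Q) : Submodule ℝ (CCl Q) :=
  (VC Q).restrictScalars ℝ ⊓ fixedPoints σ

/-- Multiplication by `i`, as a real-linear endomorphism of `ℂl(V)`. -/
def mulI (Q : QuadraticForm ℝ V) : CCl Q →ₗ[ℝ] CCl Q where
  toFun x := Complex.I • x
  map_add' x y := smul_add _ x y
  map_smul' r x := smul_comm Complex.I r x

/-- The real subspace `V ⊆ V^ℂ ⊆ ℂl(V)`. -/
def Vreal (Q : QuadraticForm ℝ V) : Submodule ℝ (CCl Q) :=
  Submodule.span ℝ (Set.range (ιr Q))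

/-- The canonical real structure `c` (characterized by fixing `V` pointwise). -/
def IsCanonicalC {Q : QuadraticForm ℝ V} (c : RealStructure Q) : Prop :=
  ∀ v : V, c.toFun (ιr Q v) = ιr Q v

/-- `σ` is admissible iff it commutes with the canonical real structure `c`. -/
def Admissible {Q : QuadraticForm ℝ V} (c σ : RealStructure Q) : Prop :=
  ∀ x, σ.toFun (c.toFun x) = c.toFun (σ.toFun x)

/-- Nondegeneracy of a real quadratic form, via its polar form. -/
def QFNondeg (Q : QuadraticForm ℝ V) : Prop :=
  ∀ v : V, (∀ w : V, QuadraticMap.polar Q v w = 0) → v = 0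

/-- A hermitian sesquilinear form (conjugate-linear in the first argument). -/
structure SesqForm (K : Type*) [AddCommGroup K] [Module ℂ K] where
  form : K → K → ℂ
  add_left : ∀ x y z : K, form (x + y) z = form x z + form y z
  add_right : ∀ x y z : K, form x (y + z) = form x y + form x z
  smul_left : ∀ (a : ℂ) (x y : K), form (a • x) y = starRingEnd ℂ a * form x y
  smul_right : ∀ (a : ℂ) (x y : K), form x (a • y) = a * form x y
  herm : ∀ x y : K, form y x = starRingEnd ℂ (form x y)

section KreinDefs

variable {K : Type*} [AddCommGroup K] [Module ℂ K]

/-- Nondegeneracy: a nondegenerate hermitian form is a Krein product. -/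
def SesqForm.Nondeg (h : SesqForm K) : Prop :=
  ∀ x : K, (∀ y : K, h.form x y = 0) → x = 0

/-- Positive definiteness of a sesquilinear form. -/
def FPosDef (f : K → K → ℂ) : Prop := ∀ x : K, x ≠ 0 → ∃ r : ℝ, 0 < r ∧ f x x = r

/-- Negative definiteness of a sesquilinear form. -/
def FNegDef (f : K → K → ℂ) : Prop := ∀ x : K, x ≠ 0 → ∃ r : ℝ, r < 0 ∧ f x x = r

/-- Definiteness of a sesquilinear form. -/
def FDefinite (f : K → K → ℂ) : Prop := FPosDef f ∨ FNegDef f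

/-- `f` is neutral: it admits an orthogonal decomposition into a positive definite
and a negative definite part of equal dimensions (equal indices of inertia). -/
def FNeutral (f : K → K → ℂ) : Prop :=
  ∃ P N : Submodule ℂ K, P ⊓ N = ⊥ ∧ P ⊔ N = ⊤
    ∧ (∀ x ∈ P, ∀ y ∈ N, f x y = 0)
    ∧ (∀ x ∈ P, x ≠ 0 → ∃ r : ℝ, 0 < r ∧ f x x = r)
    ∧ (∀ y ∈ N, y ≠ 0 → ∃ r : ℝ, r < 0 ∧ f y y = r)
    ∧ Module.finrank ℂ P = Module.finrank ℂ N

end KreinDefs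

/-- The σ-product `(a,b)_σ = τ_n(σ(aᵀ)b)` on `ℂl(V)`. -/
def sprod {Q : QuadraticForm ℝ V} (σ : RealStructure Q) (τ : CCl Q →ₗ[ℂ] ℂ)
    (a b : CCl Q) : ℂ :=
  τ (σ.toFun (CliffordAlgebra.reverse a) * b)

section CliffordMonomials

variable {A I : Type*} [Ring A] [DecidableEq I]

/-- The product, along the list `L`, of the generators `e i` with `i ∈ S`. -/
def listMonomial (e : I → A) (L : List I) (S : Finset I) : A :=
  (L.map fun i => if i ∈ S then e i else 1).prod

theorem listMonomial_cons (e : I → A) (i : I) (L : List I) (S : Finset I) :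
    listMonomial e (i :: L) S = (if i ∈ S then e i else 1) * listMonomial e L S := by
  simp [listMonomial]

theorem listMonomial_empty (e : I → A) (L : List I) : listMonomial e L ∅ = 1 := by
  induction L with
  | nil => rfl
  | cons i L ih => simp [listMonomial_cons, ih]

theorem listMonomial_symmDiff_singleton_of_notMem (e : I → A) {L : List I} {j : I} (hj : j ∉ L)
    (S : Finset I) : listMonomial e L (symmDiff S {j}) = listMonomial e L S := by
  unfold listMonomial
  congr 1
  refine List.map_congr_left fun i hi => ?_
  have hij : i ≠ j := fun h => hj (h ▸ hi)
  simp [Finset.mem_symmDiff, hij]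

theorem mul_listMonomial (e : I → A) (hsq : ∀ i, e i * e i = 1)
    (hanti : ∀ i j, i ≠ j → e i * e j = -(e j * e i)) (j : I) (S : Finset I) {L : List I}
    (hL : L.Nodup) (hj : j ∈ L) :
    e j * listMonomial e L S = listMonomial e L (symmDiff S {j}) ∨
      e j * listMonomial e L S = -listMonomial e L (symmDiff S {j}) := by
  induction L with
  | nil => simp at hj
  | cons i L ih =>
    rw [List.nodup_cons] at hL
    rw [listMonomial_cons, listMonomial_cons]
    by_cases hij : i = j
    · subst hij
      left
      rw [listMonomial_symmDiff_singleton_of_notMem e hL.1]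
      by_cases hS : i ∈ S
      · simp [hS, Finset.mem_symmDiff, ← mul_assoc, hsq]
      · simp [hS, Finset.mem_symmDiff]
    · have hmem : i ∈ symmDiff S {j} ↔ i ∈ S := by simp [Finset.mem_symmDiff, hij]
      have hjL : j ∈ L := by
        rcases List.mem_cons.1 hj with h | h
        · exact absurd h.symm hij
        · exact h
      simp only [hmem]
      by_cases hS : i ∈ S
      · simp only [hS, if_true]
        rw [← mul_assoc, hanti j i (Ne.symm hij), neg_mul, mul_assoc]
        rcases ih hL.2 hjL with h | h <;> rw [h] <;> simp
      · simpa [hS] using ih hL.2 hjL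

/-- The product of the generators `e i`, `i ∈ S`, in a fixed order. -/
def monomial [Fintype I] (e : I → A) (S : Finset I) : A :=
  listMonomial e Finset.univ.toList S

theorem star_monomial_mul_self [Fintype I] [StarRing A] (e : I → A) (hsq : ∀ i, e i * e i = 1)
    (hstar : ∀ i, star (e i) = e i) (S : Finset I) :
    star (monomial e S) * monomial e S = 1 := by
  unfold monomial
  induction (Finset.univ : Finset I).toList with
  | nil => simp [listMonomial]
  | cons i L ih =>
    rw [listMonomial_cons, star_mul, mul_assoc, ← mul_assoc (star (ite _ _ _))]
    by_cases hS : i ∈ S <;> simp [hS, hsq, hstar, ih]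

variable [Algebra ℂ A]

theorem span_range_listMonomial (e : I → A) (hsq : ∀ i, e i * e i = 1)
    (hanti : ∀ i j, i ≠ j → e i * e j = -(e j * e i)) {L : List I} (hL : L.Nodup)
    (hmem : ∀ i, i ∈ L) (hadj : Algebra.adjoin ℂ (Set.range e) = ⊤) :
    Submodule.span ℂ (Set.range (listMonomial e L)) = ⊤ := by
  have hstep : ∀ x : A, x ∈ Algebra.adjoin ℂ (Set.range e) →
      ∀ y ∈ Submodule.span ℂ (Set.range (listMonomial e L)),
        x * y ∈ Submodule.span ℂ (Set.range (listMonomial e L)) := by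
    intro x hx
    induction hx using Algebra.adjoin_induction with
    | mem x hx =>
      obtain ⟨j, rfl⟩ := hx
      intro y hy
      induction hy using Submodule.span_induction with
      | mem y hy =>
        obtain ⟨S, rfl⟩ := hy
        rcases mul_listMonomial e hsq hanti j S hL (hmem j) with h | h <;> rw [h]
        · exact Submodule.subset_span ⟨_, rfl⟩
        · exact Submodule.neg_mem _ (Submodule.subset_span ⟨_, rfl⟩)
      | zero => simp
      | add y z _ _ hy hz => rw [mul_add]; exact Submodule.add_mem _ hy hz
      | smul a y _ hy => rw [mul_smul_comm]; exact Submodule.smul_mem _ _ hy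
    | algebraMap r =>
      intro y hy
      rw [← Algebra.smul_def]
      exact Submodule.smul_mem _ _ hy
    | add x z _ _ hx hz =>
      intro y hy
      rw [add_mul]
      exact Submodule.add_mem _ (hx y hy) (hz y hy)
    | mul x z _ _ hx hz =>
      intro y hy
      rw [mul_assoc]
      exact hx _ (hz y hy)
  rw [eq_top_iff]
  intro x _
  have h := hstep x (hadj ▸ Algebra.mem_top) 1
    (Submodule.subset_span ⟨∅, listMonomial_empty e L⟩)
  rwa [mul_one] at h

theorem listMonomial_mul (e : I → A) (hanti : ∀ i j, i ≠ j → e i * e j = -(e j * e i))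
    (j : I) (S : Finset I) (L : List I) :
    listMonomial e L S * e j =
      (L.map fun i => if i ∈ S.erase j then (-1 : ℂ) else 1).prod • (e j * listMonomial e L S) := by
  induction L with
  | nil => simp [listMonomial]
  | cons i L ih =>
    rw [listMonomial_cons, mul_assoc, ih, List.map_cons, List.prod_cons, mul_smul_comm,
      mul_comm, mul_smul]
    congr 1
    by_cases hS : i ∈ S
    · by_cases hij : i = j
      · subst hij
        simp [hS]
      · simp only [hS, Finset.mem_erase, hij, ne_eq, not_false_eq_true, and_self, if_true,
          neg_smul, one_smul]
        rw [← mul_assoc, ← mul_assoc, hanti i j hij, neg_mul]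
    · simp [hS]

variable [Fintype I]

theorem monomial_mul (e : I → A) (hanti : ∀ i j, i ≠ j → e i * e j = -(e j * e i))
    (j : I) (S : Finset I) :
    monomial e S * e j = ((-1 : ℂ) ^ (S.erase j).card) • (e j * monomial e S) := by
  unfold monomial
  rw [listMonomial_mul e hanti]
  congr 1
  rw [Finset.prod_map_toList, Finset.prod_ite_mem]
  simp

theorem exists_erase_card_parity_ne (heven : Even (Fintype.card I)) {S T : Finset I}
    (hST : S ≠ T) : ∃ j, ¬ Even ((S.erase j).card + (T.erase j).card) := by
  by_contra! h
  have key : ∀ j, Even (S.card + T.card) ↔ (j ∈ S ↔ j ∈ T) := by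
    intro j
    have hj := h j
    by_cases hS : j ∈ S <;> by_cases hT : j ∈ T <;>
      simp only [hS, hT, iff_true, iff_false, not_true]
    · have h1 := Finset.card_erase_add_one hS
      have h2 := Finset.card_erase_add_one hT
      grind
    · have h1 := Finset.card_erase_add_one hS
      rw [Finset.erase_eq_of_notMem hT] at hj
      grind
    · have h2 := Finset.card_erase_add_one hT
      rw [Finset.erase_eq_of_notMem hS] at hj
      grind
    · rw [Finset.erase_eq_of_notMem hS, Finset.erase_eq_of_notMem hT] at hj
      exact hj
  by_cases hpar : Even (S.card + T.card)
  · exact hST (Finset.ext fun j => (key j).1 hpar)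
  · have hT : T = Sᶜ := by
      ext j
      have := mt (key j).2 hpar
      rw [Finset.mem_compl]
      tauto
    rw [hT, Finset.card_add_card_compl] at hpar
    exact hpar heven

theorem trace_star_monomial_mul_monomial [StarRing A] [StarModule ℂ A] (e : I → A)
    (hsq : ∀ i, e i * e i = 1) (hanti : ∀ i j, i ≠ j → e i * e j = -(e j * e i))
    (hstar : ∀ i, star (e i) = e i) (heven : Even (Fintype.card I)) (τ : A →ₗ[ℂ] ℂ)
    (htr : ∀ a b, τ (a * b) = τ (b * a)) {S T : Finset I} (hST : S ≠ T) :
    τ (star (monomial e S) * monomial e T) = 0 := by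
  obtain ⟨j, hj⟩ := exists_erase_card_parity_ne heven hST
  have h1 := monomial_mul e hanti j T
  have h2 := congrArg star (monomial_mul e hanti j S)
  simp only [star_mul, star_smul, hstar, star_pow, star_neg, star_one] at h2
  have hX : τ (e j * (star (monomial e S) * monomial e T) * e j) =
      τ (star (monomial e S) * monomial e T) := by
    rw [mul_assoc, htr, mul_assoc, hsq, mul_one]
  have hY : e j * (star (monomial e S) * monomial e T) * e j =
      -(star (monomial e S) * monomial e T) := by
    rw [← mul_assoc, h2, mul_assoc, h1, smul_mul_assoc, mul_smul_comm, smul_smul, ← pow_add,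
      Odd.neg_one_pow (Nat.not_even_iff_odd.1 hj), mul_assoc, ← mul_assoc (e j) (e j), hsq,
      one_mul, neg_smul, one_smul]
  rw [hY, map_neg] at hX
  linear_combination (-1 / 2 : ℂ) * hX

theorem trace_star_mul_self_pos [StarRing A] [StarModule ℂ A] (e : I → A)
    (hsq : ∀ i, e i * e i = 1) (hanti : ∀ i j, i ≠ j → e i * e j = -(e j * e i))
    (hstar : ∀ i, star (e i) = e i) (hadj : Algebra.adjoin ℂ (Set.range e) = ⊤)
    (heven : Even (Fintype.card I)) (τ : A →ₗ[ℂ] ℂ) (hone : τ 1 = 1)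
    (htr : ∀ a b, τ (a * b) = τ (b * a)) {x : A} (hx : x ≠ 0) :
    ∃ r : ℝ, 0 < r ∧ τ (star x * x) = r := by
  have hspan : Submodule.span ℂ (Set.range (monomial e)) = ⊤ :=
    span_range_listMonomial e hsq hanti (Finset.nodup_toList _) (by simp) hadj
  obtain ⟨a, rfl⟩ := (Submodule.mem_span_range_iff_exists_fun ℂ).1
    (hspan ▸ Submodule.mem_top : x ∈ Submodule.span ℂ (Set.range (monomial e)))
  obtain ⟨S, hS⟩ : ∃ S, a S ≠ 0 := by
    by_contra! h
    exact hx (by simp [h])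
  refine ⟨∑ S, Complex.normSq (a S), ?_, ?_⟩
  · exact Finset.sum_pos' (fun _ _ => Complex.normSq_nonneg _)
      ⟨S, Finset.mem_univ _, Complex.normSq_pos.2 hS⟩
  · rw [star_sum, Finset.sum_mul, map_sum, Complex.ofReal_sum]
    refine Finset.sum_congr rfl fun T _ => ?_
    rw [Finset.mul_sum, map_sum, Finset.sum_eq_single T]
    · rw [star_smul, smul_mul_smul_comm, star_monomial_mul_self e hsq hstar, map_smul, hone,
        smul_eq_mul, mul_one, Complex.normSq_eq_conj_mul_self]
      rfl
    · intro U _ hU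
      rw [star_smul, smul_mul_smul_comm, map_smul,
        trace_star_monomial_mul_monomial e hsq hanti hstar heven τ htr hU.symm, smul_zero]
    · simp

end CliffordMonomials

namespace RealStructure

variable {Q : QuadraticForm ℝ V} (σ : RealStructure Q)

theorem map_neg (x : CCl Q) : σ.toFun (-x) = -σ.toFun x := by
  have h := σ.map_smul' (-1) x
  simpa using h

theorem map_sub (x y : CCl Q) : σ.toFun (x - y) = σ.toFun x - σ.toFun y := by
  rw [sub_eq_add_neg, σ.map_add', σ.map_neg, ← sub_eq_add_neg]

theorem map_I_smul (x : CCl Q) : σ.toFun (Complex.I • x) = -(Complex.I • σ.toFun x) := by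
  rw [σ.map_smul', Complex.conj_I, neg_smul]

theorem map_algebraMap (z : ℂ) :
    σ.toFun (algebraMap ℂ (CCl Q) z) = algebraMap ℂ (CCl Q) (starRingEnd ℂ z) := by
  rw [Algebra.algebraMap_eq_smul_one, σ.map_smul', σ.map_one', ← Algebra.algebraMap_eq_smul_one]

theorem reverse_map (x : CCl Q) :
    CliffordAlgebra.reverse (σ.toFun x) = σ.toFun (CliffordAlgebra.reverse x) := by
  induction x using CliffordAlgebra.induction with
  | algebraMap r =>
    rw [σ.map_algebraMap, CliffordAlgebra.reverse.commutes, CliffordAlgebra.reverse.commutes,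
      σ.map_algebraMap]
  | ι v =>
    obtain ⟨w, hw⟩ := σ.stable _ ⟨v, rfl⟩
    rw [CliffordAlgebra.reverse_ι, ← hw, CliffordAlgebra.reverse_ι]
  | mul a b ha hb =>
    rw [σ.map_mul', CliffordAlgebra.reverse.map_mul, ha, hb, CliffordAlgebra.reverse.map_mul,
      σ.map_mul']
  | add a b ha hb => rw [σ.map_add', _root_.map_add, ha, hb, _root_.map_add, σ.map_add']

/-- The star operation `a ↦ σ(aᵀ)` defined by a real structure. -/
abbrev starRing : StarRing (CCl Q) where
  star x := σ.toFun (CliffordAlgebra.reverse x)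
  star_involutive x := by
    change σ.toFun (CliffordAlgebra.reverse (σ.toFun (CliffordAlgebra.reverse x))) = x
    rw [σ.reverse_map, CliffordAlgebra.reverse_reverse, σ.invol]
  star_mul x y := by
    change σ.toFun (CliffordAlgebra.reverse (x * y)) = _
    rw [CliffordAlgebra.reverse.map_mul, σ.map_mul']
  star_add x y := by
    change σ.toFun (CliffordAlgebra.reverse (x + y)) = _
    rw [_root_.map_add, σ.map_add']

end RealStructure

section VectorSpaces

variable {Q : QuadraticForm ℝ V}

theorem ι_baseChange_injective :
    Function.Injective (CliffordAlgebra.ι (Q.baseChange ℂ)) := by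
  intro x y hxy
  have h := congrArg (CliffordAlgebra.equivExterior (Q.baseChange ℂ)) hxy
  simp only [CliffordAlgebra.equivExterior, CliffordAlgebra.changeFormEquiv_apply,
    CliffordAlgebra.changeForm_ι] at h
  exact (ExteriorAlgebra.ι_inj ℂ x y).1 h

theorem ιr_ne_zero {v : V} (hv : v ≠ 0) : ιr Q v ≠ 0 := by
  intro h
  refine hv (Module.FaithfullyFlat.tensorProduct_mk_injective (A := ℝ) (B := ℂ) V ?_)
  apply ι_baseChange_injective (Q := Q)
  rw [TensorProduct.mk_apply, TensorProduct.mk_apply, TensorProduct.tmul_zero, _root_.map_zero]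
  exact h

theorem finrank_VC [FiniteDimensional ℝ V] :
    Module.finrank ℂ (VC Q) = Module.finrank ℝ V := by
  unfold VC
  rw [LinearMap.finrank_range_of_inj ι_baseChange_injective, Module.finrank_baseChange]

theorem reverse_of_mem_VC {w : CCl Q} (hw : w ∈ VC Q) : CliffordAlgebra.reverse w = w := by
  obtain ⟨v, rfl⟩ := hw
  exact CliffordAlgebra.reverse_ι _

theorem exists_ιr_add_I_smul_ιr {w : CCl Q} (hw : w ∈ VC Q) :
    ∃ a b : V, w = ιr Q a + Complex.I • ιr Q b := by
  obtain ⟨v, rfl⟩ := hw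
  induction v using TensorProduct.induction_on with
  | zero => exact ⟨0, 0, by simp [ιr]⟩
  | tmul z v =>
    refine ⟨z.re • v, z.im • v, ?_⟩
    simp only [ιr]
    rw [← _root_.map_smul, ← _root_.map_add]
    congr 1
    rw [← TensorProduct.smul_tmul, ← TensorProduct.smul_tmul, TensorProduct.smul_tmul',
      ← TensorProduct.add_tmul]
    congr 1
    apply Complex.ext <;> simp
  | add x y hx hy =>
    obtain ⟨a, b, hab⟩ := hx
    obtain ⟨a', b', hab'⟩ := hy
    refine ⟨a + a', b + b', ?_⟩
    have hadd : ∀ u v : V, ιr Q (u + v) = ιr Q u + ιr Q v := fun u v => by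
      simp [ιr, TensorProduct.tmul_add]
    rw [_root_.map_add, hab, hab', hadd, hadd, smul_add]
    abel

theorem ιr_mem_VC (v : V) : ιr Q v ∈ VC Q := ⟨_, rfl⟩

theorem ιr_mem_Vreal (v : V) : ιr Q v ∈ Vreal Q := Submodule.subset_span ⟨v, rfl⟩

theorem ιr_mul_self (v : V) : ιr Q v * ιr Q v = algebraMap ℂ (CCl Q) (Q v : ℝ) := by
  rw [ιr, CliffordAlgebra.ι_sq_scalar]
  simp

theorem ιr_mul_add_swap (a b : V) : ιr Q a * ιr Q b + ιr Q b * ιr Q a =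
    algebraMap ℂ (CCl Q) (QuadraticMap.polar Q a b : ℝ) := by
  have hadd : ιr Q (a + b) = ιr Q a + ιr Q b := by simp [ιr, TensorProduct.tmul_add]
  have h := ιr_mul_self (Q := Q) (a + b)
  rw [hadd, add_mul, mul_add, mul_add, ιr_mul_self, ιr_mul_self] at h
  rw [QuadraticMap.polar, Complex.ofReal_sub, Complex.ofReal_sub, _root_.map_sub,
    _root_.map_sub, ← h]
  abel

theorem finiteDimensional_VFix [FiniteDimensional ℝ V] (σ : RealStructure Q) :
    FiniteDimensional ℝ (VFix σ) := by
  have h1 : Module.Finite ℂ (VC Q) := by unfold VC; infer_instance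
  have h2 : Module.Finite ℝ ((VC Q).restrictScalars ℝ) := FiniteDimensional.complexToReal (VC Q)
  exact Submodule.finiteDimensional_of_le (inf_le_left : VFix σ ≤ (VC Q).restrictScalars ℝ)

theorem span_VFix (σ : RealStructure Q) :
    Submodule.span ℂ (VFix σ : Set (CCl Q)) = VC Q := by
  apply le_antisymm
  · exact Submodule.span_le.2 fun w hw => hw.1
  · intro w hw
    have hσ := σ.stable w hw
    have h1 : w + σ.toFun w ∈ VFix σ :=
      ⟨Submodule.add_mem _ hw hσ, by
        change σ.toFun _ = _
        rw [σ.map_add', σ.invol, add_comm]⟩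
    have h2 : Complex.I • (w - σ.toFun w) ∈ VFix σ :=
      ⟨Submodule.smul_mem (VC Q) _ (Submodule.sub_mem _ hw hσ), by
        change σ.toFun _ = _
        rw [σ.map_I_smul, σ.map_sub, σ.invol, ← smul_neg, neg_sub]⟩
    have h3 : w = (1 / 2 : ℂ) • (w + σ.toFun w) +
        (-(1 / 2) * Complex.I) • (Complex.I • (w - σ.toFun w)) := by
      rw [smul_smul, mul_assoc, Complex.I_mul_I]
      module
    rw [h3]
    exact Submodule.add_mem _ (Submodule.smul_mem _ _ (Submodule.subset_span h1))
      (Submodule.smul_mem _ _ (Submodule.subset_span h2))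

/-- The real bilinear form `(x, y) ↦ Re τ(xy)` on `V_σ`. -/
def traceForm (σ : RealStructure Q) (τ : CCl Q →ₗ[ℂ] ℂ) : LinearMap.BilinForm ℝ (VFix σ) :=
  LinearMap.mk₂ ℝ (fun x y => (τ (x * y)).re)
    (fun x y z => by simp [add_mul])
    (fun r x y => by
      rw [Submodule.coe_smul, smul_mul_assoc, ← Complex.coe_smul, _root_.map_smul]
      simp)
    (fun x y z => by simp [mul_add])
    (fun r x y => by
      rw [Submodule.coe_smul, mul_smul_comm, ← Complex.coe_smul, _root_.map_smul]
      simp)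

theorem traceForm_apply (σ : RealStructure Q) (τ : CCl Q →ₗ[ℂ] ℂ) (x y : VFix σ) :
    traceForm σ τ x y = (τ (x * y)).re := rfl

theorem linearIndependent_of_anticommute {A I : Type*} [Ring A] [Algebra ℂ A] (hA : Nontrivial A)
    {e : I → A} (hsq : ∀ i, e i * e i = 1) (hanti : ∀ i j, i ≠ j → e i * e j = -(e j * e i)) :
    LinearIndependent ℂ e := by
  classical
  rw [linearIndependent_iff']
  intro s g hg i hi
  have h : ∑ j ∈ s, g j • (e j * e i + e i * e j) = 0 := by
    have h1 : (∑ j ∈ s, g j • e j) * e i + e i * ∑ j ∈ s, g j • e j = 0 := by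
      rw [hg, zero_mul, mul_zero, add_zero]
    simpa only [Finset.sum_mul, Finset.mul_sum, smul_mul_assoc, mul_smul_comm,
      ← Finset.sum_add_distrib, ← smul_add] using h1
  rw [Finset.sum_eq_single_of_mem i hi] at h
  · rw [hsq, ← two_smul ℂ (1 : A), smul_smul, smul_eq_zero] at h
    simpa using h
  · intro j _ hj
    rw [hanti j i hj, neg_add_cancel, smul_zero]

theorem exists_orthonormal_generators [FiniteDimensional ℝ V] (σ : RealStructure Q)
    (τ : CCl Q →ₗ[ℂ] ℂ) (hone : τ 1 = 1) (htr : ∀ a b : CCl Q, τ (a * b) = τ (b * a))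
    (hpos : ∀ w ∈ VFix σ, w ≠ 0 → ∃ r : ℝ, 0 < r ∧ w * w = algebraMap ℂ (CCl Q) (r : ℂ)) :
    ∃ e : Fin (Module.finrank ℝ V) → CCl Q, (∀ i, e i ∈ VFix σ) ∧ (∀ i, e i * e i = 1) ∧
      (∀ i j, i ≠ j → e i * e j = -(e j * e i)) ∧ Algebra.adjoin ℂ (Set.range e) = ⊤ := by
  have : FiniteDimensional ℝ (VFix σ) := finiteDimensional_VFix σ
  have hA : Nontrivial (CCl Q) := inferInstance
  have hτ : ∀ z : ℂ, τ (algebraMap ℂ (CCl Q) z) = z := fun z => by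
    rw [Algebra.algebraMap_eq_smul_one, _root_.map_smul, hone, smul_eq_mul, mul_one]
  have hsq : ∀ w ∈ VFix σ, w * w = algebraMap ℂ (CCl Q) ((τ (w * w)).re : ℂ) := by
    intro w hw
    by_cases h0 : w = 0
    · simp [h0]
    · obtain ⟨r, _, hr⟩ := hpos w hw h0
      rw [hr, hτ, Complex.ofReal_re]
  have hsymm : LinearMap.IsSymm (traceForm σ τ) := ⟨fun x y => by
    rw [traceForm_apply, traceForm_apply, RingHom.id_apply, htr]⟩
  obtain ⟨b, hb⟩ := LinearMap.BilinForm.exists_orthogonal_basis (B := traceForm σ τ) hsymm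
  have hb0 : ∀ i, (b i : CCl Q) ≠ 0 := fun i => by
    simpa using b.ne_zero i
  have hanti : ∀ i j, i ≠ j → (b i : CCl Q) * b j = -((b j : CCl Q) * b i) := by
    intro i j hij
    have h := hsq _ (b i + b j).2
    have hij' : (τ ((b i : CCl Q) * b j)).re = 0 := hb hij
    have hji' : (τ ((b j : CCl Q) * b i)).re = 0 := hb hij.symm
    rw [Submodule.coe_add, add_mul, mul_add, mul_add] at h
    simp only [_root_.map_add, Complex.add_re, hij', hji', Complex.ofReal_add, add_zero,
      zero_add] at h
    rw [← hsq _ (b i).2, ← hsq _ (b j).2] at h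
    rw [eq_neg_iff_add_eq_zero]
    have h' := sub_eq_zero.2 h
    rw [← h']
    abel
  choose r hr hrsq using fun i => hpos (b i) (b i).2 (hb0 i)
  let e : Fin (Module.finrank ℝ (VFix σ)) → CCl Q :=
    fun i => (((√(r i))⁻¹ : ℝ) : ℂ) • (b i : CCl Q)
  have he : ∀ i, e i ∈ VFix σ := fun i => by
    simp only [e, Complex.coe_smul]
    exact Submodule.smul_mem _ _ (b i).2
  have hesq : ∀ i, e i * e i = 1 := fun i => by
    simp only [e]
    rw [smul_mul_smul_comm, hrsq, Algebra.algebraMap_eq_smul_one, smul_smul, ← Complex.ofReal_mul,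
      ← Complex.ofReal_mul, ← mul_inv, Real.mul_self_sqrt (hr i).le, inv_mul_cancel₀ (hr i).ne',
      Complex.ofReal_one, one_smul]
  have heanti : ∀ i j, i ≠ j → e i * e j = -(e j * e i) := fun i j hij => by
    simp only [e]
    rw [smul_mul_smul_comm, smul_mul_smul_comm, hanti i j hij, smul_neg, mul_comm]
  have hspan : Submodule.span ℂ (Set.range e) = VC Q := by
    apply le_antisymm
    · rw [Submodule.span_le]
      rintro _ ⟨i, rfl⟩
      exact (he i).1
    · rw [← span_VFix σ, Submodule.span_le]
      intro w hw
      have hw' := congrArg Subtype.val (b.sum_repr ⟨w, hw⟩)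
      simp only [Submodule.coe_sum, Submodule.coe_smul] at hw'
      rw [← hw']
      refine Submodule.sum_mem _ fun i _ => ?_
      have hbi : (b i : CCl Q) = ((√(r i) : ℝ) : ℂ) • e i := by
        simp only [e]
        rw [smul_smul, ← Complex.ofReal_mul, mul_inv_cancel₀ (Real.sqrt_pos.2 (hr i)).ne',
          Complex.ofReal_one, one_smul]
      rw [hbi, ← Complex.coe_smul]
      exact Submodule.smul_mem _ _ (Submodule.smul_mem _ _ (Submodule.subset_span ⟨i, rfl⟩))
  have hcard : Module.finrank ℝ (VFix σ) = Module.finrank ℝ V := by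
    have h := finrank_span_eq_card (linearIndependent_of_anticommute hA hesq heanti)
    rw [hspan, finrank_VC, Fintype.card_fin] at h
    exact h.symm
  have hadj : Algebra.adjoin ℂ (Set.range e) = ⊤ := by
    rw [eq_top_iff, ← CliffordAlgebra.adjoin_range_ι, Algebra.adjoin_le_iff]
    intro w hw
    have hw' : w ∈ Submodule.span ℂ (Set.range e) := hspan ▸ hw
    exact Algebra.span_le_adjoin ℂ _ hw'
  rw [← hcard]
  exact ⟨e, he, hesq, heanti, hadj⟩

theorem sprod_posDef_of_VFix_posDef [FiniteDimensional ℝ V]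
    (hdim : Even (Module.finrank ℝ V)) (σ : RealStructure Q)
    (τ : CCl Q →ₗ[ℂ] ℂ) (hone : τ 1 = 1) (htr : ∀ a b : CCl Q, τ (a * b) = τ (b * a))
    (hpos : ∀ w ∈ VFix σ, w ≠ 0 → ∃ r : ℝ, 0 < r ∧ w * w = algebraMap ℂ (CCl Q) (r : ℂ)) :
    FPosDef (sprod σ τ) := by
  obtain ⟨e, he, hsq, hanti, hadj⟩ := exists_orthonormal_generators σ τ hone htr hpos
  let _ : StarRing (CCl Q) := σ.starRing
  have : StarModule ℂ (CCl Q) := ⟨fun z x => by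
    change σ.toFun (CliffordAlgebra.reverse (z • x)) = _
    rw [_root_.map_smul, σ.map_smul']
    rfl⟩
  have hstar : ∀ i, star (e i) = e i := fun i => by
    change σ.toFun (CliffordAlgebra.reverse (e i)) = e i
    rw [reverse_of_mem_VC (he i).1, (he i).2]
  intro x hx
  exact trace_star_mul_self_pos e hsq hanti hstar hadj (by simpa using hdim) τ hone htr hx

end VectorSpaces

section Comparison

variable {Q : QuadraticForm ℝ V} {σ : RealStructure Q} {Qσ : V → ℝ}

theorem algebraMap_CCl_injective : Function.Injective (algebraMap ℂ (CCl Q)) :=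
  FaithfulSMul.algebraMap_injective ℂ (CCl Q)

/-- A real structure commuting with the canonical one preserves `V`. -/
theorem exists_map_ιr_eq {c : RealStructure Q} (hc : IsCanonicalC c) (hadm : Admissible c σ)
    (v : V) : ∃ a : V, σ.toFun (ιr Q v) = ιr Q a := by
  obtain ⟨a, b, hab⟩ := exists_ιr_add_I_smul_ιr (σ.stable _ (ιr_mem_VC v))
  have h := hadm (ιr Q v)
  rw [hc, hab, c.map_add', c.map_I_smul, hc, hc, add_right_inj, eq_neg_iff_add_eq_zero,
    ← two_smul ℂ, smul_eq_zero] at h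
  exact ⟨a, by rw [hab, h.resolve_left two_ne_zero, add_zero]⟩

/-- On `V_σ` the form `Q` is a sum of two values of `Q_σ`. -/
theorem exists_mul_self_eq_add {c : RealStructure Q} (hc : IsCanonicalC c)
    (hadm : Admissible c σ) (hQσ : ∀ v : V, σ.toFun (ιr Q v) * ιr Q v +
      ιr Q v * σ.toFun (ιr Q v) = algebraMap ℂ (CCl Q) ((2 * Qσ v : ℝ) : ℂ))
    {w : CCl Q} (hw : w ∈ VFix σ) :
    ∃ a b : V, w = ιr Q a + Complex.I • ιr Q b ∧
      w * w = algebraMap ℂ (CCl Q) ((Qσ a + Qσ b : ℝ) : ℂ) := by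
  obtain ⟨a, b, hab⟩ := exists_ιr_add_I_smul_ιr hw.1
  refine ⟨a, b, hab, ?_⟩
  obtain ⟨a', ha⟩ := exists_map_ιr_eq hc hadm a
  obtain ⟨b', hb⟩ := exists_map_ιr_eq hc hadm b
  have h1 : σ.toFun w = w := hw.2
  rw [hab, σ.map_add', σ.map_I_smul, ha, hb] at h1
  have h2 := congrArg c.toFun h1
  rw [c.map_add', c.map_add', c.map_neg, c.map_I_smul, c.map_I_smul, hc, hc, hc, hc,
    neg_neg] at h2
  have haa : ιr Q a' = ιr Q a := by
    linear_combination (norm := module) (1 / 2 : ℂ) • h1 + (1 / 2 : ℂ) • h2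
  have hbb : ιr Q b' = -ιr Q b := by
    rw [haa, add_right_inj, ← smul_neg] at h2
    exact smul_right_injective _ Complex.I_ne_zero h2
  rw [haa] at ha
  rw [hbb] at hb
  have hQa := hQσ a
  have hQb := hQσ b
  rw [ha] at hQa
  rw [hb] at hQb
  have hcross : ιr Q a * ιr Q b + ιr Q b * ιr Q a = 0 := by
    have h3 := congrArg σ.toFun (ιr_mul_add_swap (Q := Q) a b)
    rw [σ.map_add', σ.map_mul', σ.map_mul', ha, hb, σ.map_algebraMap, Complex.conj_ofReal,
      ← ιr_mul_add_swap a b] at h3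
    have h4 : (2 : ℂ) • (ιr Q a * ιr Q b + ιr Q b * ιr Q a) = 0 := by
      rw [two_smul]
      nth_rewrite 1 [← h3]
      noncomm_ring
    exact (smul_eq_zero.1 h4).resolve_left two_ne_zero
  have hexp : (2 : ℂ) • (w * w) = (ιr Q a * ιr Q a + ιr Q a * ιr Q a) +
      (-ιr Q b * ιr Q b + ιr Q b * -ιr Q b) +
      (2 * Complex.I) • (ιr Q a * ιr Q b + ιr Q b * ιr Q a) := by
    rw [hab, add_mul, mul_add, mul_add, smul_mul_smul_comm, Complex.I_mul_I, mul_smul_comm,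
      smul_mul_assoc, neg_mul, mul_neg]
    module
  rw [hcross, smul_zero, add_zero, hQa, hQb, ← map_add] at hexp
  apply smul_right_injective (CCl Q) (two_ne_zero (α := ℂ))
  change (2 : ℂ) • (w * w) = (2 : ℂ) • _
  rw [hexp, Algebra.smul_def, ← map_mul]
  congr 1
  push_cast
  ring

theorem pos_of_definite {c : RealStructure Q} (hc : IsCanonicalC c) (hadm : Admissible c σ)
    {v : V} {q : ℝ} (hq : σ.toFun (ιr Q v) * ιr Q v + ιr Q v * σ.toFun (ιr Q v) =
      algebraMap ℂ (CCl Q) ((2 * q : ℝ) : ℂ))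
    (hpos : ∀ w ∈ Vreal Q ⊓ VFix σ, w ≠ 0 →
      ∃ r : ℝ, 0 < r ∧ w * w = algebraMap ℂ (CCl Q) (r : ℂ))
    (hneg : ∀ w ∈ Vreal Q ⊓ (VFix σ).map (mulI Q), w ≠ 0 →
      ∃ r : ℝ, r < 0 ∧ w * w = algebraMap ℂ (CCl Q) (r : ℂ)) (hv : v ≠ 0) : 0 < q := by
  obtain ⟨a, ha⟩ := exists_map_ιr_eq hc hadm v
  have ha' : σ.toFun (ιr Q a) = ιr Q v := by rw [← ha, σ.invol]
  rw [ha] at hq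
  have hP : ιr Q v + ιr Q a ∈ Vreal Q ⊓ VFix σ :=
    ⟨Submodule.add_mem _ (ιr_mem_Vreal v) (ιr_mem_Vreal a),
      Submodule.add_mem (VC Q) (ιr_mem_VC v) (ιr_mem_VC a), by
        change σ.toFun _ = _
        rw [σ.map_add', ha, ha', add_comm]⟩
  have hN : ιr Q v - ιr Q a ∈ Vreal Q ⊓ (VFix σ).map (mulI Q) := by
    refine ⟨Submodule.sub_mem _ (ιr_mem_Vreal v) (ιr_mem_Vreal a),
      Complex.I • (ιr Q a - ιr Q v), ⟨Submodule.smul_mem (VC Q) _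
        (Submodule.sub_mem _ (ιr_mem_VC a) (ιr_mem_VC v)), ?_⟩, ?_⟩
    · change σ.toFun _ = _
      rw [σ.map_I_smul, σ.map_sub, ha, ha', ← smul_neg, neg_sub]
    · change Complex.I • Complex.I • (ιr Q a - ιr Q v) = _
      rw [smul_smul, Complex.I_mul_I, neg_one_smul, neg_sub]
  obtain ⟨p, hp, hp0⟩ : ∃ p : ℝ, (ιr Q v + ιr Q a) * (ιr Q v + ιr Q a) =
      algebraMap ℂ (CCl Q) (p : ℂ) ∧ 0 ≤ p ∧ (ιr Q v + ιr Q a ≠ 0 → 0 < p) := by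
    by_cases h0 : ιr Q v + ιr Q a = 0
    · exact ⟨0, by simp [h0], le_rfl, fun h => absurd h0 h⟩
    · obtain ⟨p, hp, h⟩ := hpos _ hP h0
      exact ⟨p, h, hp.le, fun _ => hp⟩
  obtain ⟨n, hn, hn0⟩ : ∃ n : ℝ, (ιr Q v - ιr Q a) * (ιr Q v - ιr Q a) =
      algebraMap ℂ (CCl Q) (n : ℂ) ∧ n ≤ 0 ∧ (ιr Q v - ιr Q a ≠ 0 → n < 0) := by
    by_cases h0 : ιr Q v - ιr Q a = 0
    · exact ⟨0, by simp [h0], le_rfl, fun h => absurd h0 h⟩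
    · obtain ⟨n, hn, h⟩ := hneg _ hN h0
      exact ⟨n, h, hn.le, fun _ => hn⟩
  have hpn : p - n = 4 * q := by
    have h : algebraMap ℂ (CCl Q) ((p - n : ℝ) : ℂ) =
        algebraMap ℂ (CCl Q) ((4 * q : ℝ) : ℂ) := by
      rw [show 4 * q = 2 * q + 2 * q by ring, Complex.ofReal_add, Complex.ofReal_sub, map_add,
        map_sub, ← hp, ← hn, ← hq]
      noncomm_ring
    exact_mod_cast algebraMap_CCl_injective h
  by_cases h0 : ιr Q v + ιr Q a = 0
  · have h1 : ιr Q v - ιr Q a ≠ 0 := by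
      rw [eq_neg_of_add_eq_zero_right h0, sub_neg_eq_add, ← two_smul ℂ]
      exact smul_ne_zero two_ne_zero (ιr_ne_zero hv)
    linarith [hn0.2 h1, hp0.1]
  · linarith [hp0.2 h0, hn0.1]

end Comparison

/-- For an admissible real structure `σ`, TFAE: (1) `Q` is positive definite
on `V₊` and negative definite on `V₋`; (2) `Q_σ` is positive definite; (3) `Q` restricted to
`V_σ` is positive definite; (4) the σ-product on `ℂl(V)` is positive definite. -/
theorem statement9 [FiniteDimensional ℝ V] (Q : QuadraticForm ℝ V)
    (hdim : Even (Module.finrank ℝ V)) (hQ : QFNondeg Q)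
    (τ : CCl Q →ₗ[ℂ] ℂ) (hτ1 : τ 1 = 1) (hτtr : ∀ a b : CCl Q, τ (a * b) = τ (b * a))
    (c : RealStructure Q) (hc : IsCanonicalC c)
    (σ : RealStructure Q) (hadm : Admissible c σ)
    (Qσ : V → ℝ)
    (hQσ : ∀ v : V, σ.toFun (ιr Q v) * ιr Q v + ιr Q v * σ.toFun (ιr Q v)
        = algebraMap ℂ (CCl Q) ((2 * Qσ v : ℝ) : ℂ)) :
    [ -- (1) Q positive definite on V₊ and negative definite on V₋
      ((∀ w ∈ Vreal Q ⊓ VFix σ, w ≠ 0 →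
          ∃ r : ℝ, 0 < r ∧ w * w = algebraMap ℂ (CCl Q) (r : ℂ))
        ∧ (∀ w ∈ Vreal Q ⊓ (VFix σ).map (mulI Q), w ≠ 0 →
            ∃ r : ℝ, r < 0 ∧ w * w = algebraMap ℂ (CCl Q) (r : ℂ))),
      -- (2) Q_σ positive definite on V
      (∀ v : V, v ≠ 0 → 0 < Qσ v),
      -- (3) Q restricted to V_σ positive definite
      (∀ w ∈ VFix σ, w ≠ 0 → ∃ r : ℝ, 0 < r ∧ w * w = algebraMap ℂ (CCl Q) (r : ℂ)),
      -- (4) the σ-product is positive definite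
      FPosDef (sprod σ τ) ].TFAE := by
  have halg : ∀ z : ℂ, τ (algebraMap ℂ (CCl Q) z) = z := fun z => by
    rw [Algebra.algebraMap_eq_smul_one, map_smul, hτ1, smul_eq_mul, mul_one]
  tfae_have 3 → 1 := by
    intro h
    refine ⟨fun w hw hw0 => h w hw.2 hw0, ?_⟩
    rintro _ ⟨_, u, hu, rfl⟩ hw0
    have hu0 : u ≠ 0 := by
      rintro rfl
      exact hw0 (map_zero _)
    obtain ⟨r, hr, hru⟩ := h u hu hu0
    refine ⟨-r, neg_lt_zero.2 hr, ?_⟩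
    change Complex.I • u * Complex.I • u = _
    rw [smul_mul_smul_comm, Complex.I_mul_I, hru, neg_one_smul, Complex.ofReal_neg, map_neg]
  tfae_have 1 → 2 := by
    rintro ⟨hpos, hneg⟩ v hv
    exact pos_of_definite hc hadm (hQσ v) hpos hneg hv
  tfae_have 2 → 3 := by
    intro h w hw hw0
    obtain ⟨a, b, hab, hsq⟩ := exists_mul_self_eq_add hc hadm hQσ hw
    refine ⟨_, ?_, hsq⟩
    have hzero : Qσ 0 = 0 := by
      have h0 := hQσ 0
      rw [ιr, TensorProduct.tmul_zero, map_zero, mul_zero, zero_mul, add_zero] at h0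
      have h1 := algebraMap_CCl_injective ((map_zero _).trans h0)
      norm_cast at h1
      linarith
    have hnonneg : ∀ v, 0 ≤ Qσ v := fun v => by
      by_cases hv : v = 0
      · rw [hv, hzero]
      · exact (h v hv).le
    by_cases ha : a = 0
    · have hb : b ≠ 0 := by
        rintro rfl
        exact hw0 (by simp [hab, ha, ιr])
      exact add_pos_of_nonneg_of_pos (hnonneg a) (h b hb)
    · exact add_pos_of_pos_of_nonneg (h a ha) (hnonneg b)
  tfae_have 3 → 4 := fun h => sprod_posDef_of_VFix_posDef hdim σ τ hτ1 hτtr h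
  tfae_have 4 → 3 := by
    intro h w hw hw0
    obtain ⟨r, hr, hrw⟩ := h w hw0
    refine ⟨r, hr, ?_⟩
    rw [sprod, reverse_of_mem_VC hw.1, show σ.toFun w = w from hw.2] at hrw
    obtain ⟨v, rfl⟩ := hw.1
    rw [CliffordAlgebra.ι_sq_scalar, halg] at hrw
    rw [CliffordAlgebra.ι_sq_scalar, hrw]
  tfae_finish
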